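/- arXiv:1102.1138 — 7 statements merged into one kernel-verified Lean document; each statement's English description precedes it below -/
import Mathlib

section
/- For every finite bipartite graph G=(A,B,E), the critical difference of G equals the sum of the deficiencies of the two sides: d_c(G) = δ₀(A) + δ₀(B). -/
open Finset

open scoped Classical

variable {V : Type*} [Fintype V] [DecidableEq V]

/-- The neighborhood `N(X)` of a finite set of vertices `X`. -/
noncomputable def nbr (G : SimpleGraph V) (X : Finset V) : Finset V :=
  Finset.univ.filter fun v => ∃ x ∈ X, G.Adj v x

/-- The difference `d(X) = |X| - |N(X)|` of a set of vertices. -/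
noncomputable def diffZ (G : SimpleGraph V) (X : Finset V) : ℤ :=
  (X.card : ℤ) - ((nbr G X).card : ℤ)

/-- The critical difference `d_c(G) = max {d(X) : X ⊆ V}`. -/
noncomputable def critDiff (G : SimpleGraph V) : ℤ :=
  (Finset.univ : Finset V).powerset.sup' (Finset.powerset_nonempty _) (diffZ G)

/-- A set of vertices is independent if no two of its vertices are adjacent. -/
def IsIndep (G : SimpleGraph V) (S : Finset V) : Prop :=
  ∀ u ∈ S, ∀ v ∈ S, ¬ G.Adj u v

/-- The independence number `α(G)`. -/
noncomputable def indepNum (G : SimpleGraph V) : ℕ :=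
  ((Finset.univ : Finset V).powerset.filter (IsIndep G)).sup Finset.card

/-- The critical independence difference `id_c(G) = max {d(I) : I independent}`. -/
noncomputable def idc (G : SimpleGraph V) : ℤ :=
  ((Finset.univ : Finset V).powerset.filter (IsIndep G)).sup'
    ⟨∅, by simp [IsIndep]⟩ (diffZ G)

/-- A critical independent set: an independent set `S` with `d(S) = id_c(G)`. -/
def CritIndep (G : SimpleGraph V) (S : Finset V) : Prop :=
  IsIndep G S ∧ diffZ G S = idc G

/-- A finite set of edges of `G` that are pairwise non-incident (a matching). -/
def IsMatchingSet (G : SimpleGraph V) (M : Finset (Sym2 V)) : Prop :=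
  (∀ e ∈ M, e ∈ G.edgeSet) ∧
    (M : Set (Sym2 V)).Pairwise fun e f => ∀ v : V, ¬(v ∈ e ∧ v ∈ f)

/-- The matching number `μ(G)`. -/
noncomputable def matchNum (G : SimpleGraph V) : ℕ :=
  ((Finset.univ : Finset (Sym2 V)).powerset.filter (IsMatchingSet G)).sup Finset.card

/-- A maximum independent set. -/
def IsMaxIndep (G : SimpleGraph V) (S : Finset V) : Prop :=
  IsIndep G S ∧ S.card = indepNum G

/-- `ker(G)`: the intersection of all critical independent sets. -/
noncomputable def kerSet (G : SimpleGraph V) : Finset V :=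
  Finset.univ.filter fun v => ∀ S : Finset V, CritIndep G S → v ∈ S

/-- `diadem(G)`: the union of all critical independent sets. -/
noncomputable def diademSet (G : SimpleGraph V) : Finset V :=
  Finset.univ.filter fun v => ∃ S : Finset V, CritIndep G S ∧ v ∈ S

/-- `core(G)`: the intersection of all maximum independent sets. -/
noncomputable def coreSet (G : SimpleGraph V) : Finset V :=
  Finset.univ.filter fun v => ∀ S : Finset V, IsMaxIndep G S → v ∈ S

/-- `corona(G)`: the union of all maximum independent sets. -/
noncomputable def coronaSet (G : SimpleGraph V) : Finset V :=
  Finset.univ.filter fun v => ∃ S : Finset V, IsMaxIndep G S ∧ v ∈ S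

/-- `δ₀(A) = max {δ(X) : X ⊆ A}`, the maximum deficiency over subsets of a side. -/
noncomputable def delta0 (G : SimpleGraph V) (A : Finset V) : ℤ :=
  A.powerset.sup' (Finset.powerset_nonempty _) (diffZ G)

/-- An `A`-critical set: a subset `X ⊆ A` with `δ(X) = δ₀(A)`. -/
def SideCrit (G : SimpleGraph V) (A X : Finset V) : Prop :=
  X ⊆ A ∧ diffZ G X = delta0 G A

/-- `ker_A(G)`: the intersection of all `A`-critical sets. -/
noncomputable def kerSide (G : SimpleGraph V) (A : Finset V) : Finset V :=
  Finset.univ.filter fun v => ∀ X : Finset V, SideCrit G A X → v ∈ X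

/-- `diadem_A(G)`: the union of all `A`-critical sets. -/
noncomputable def diademSide (G : SimpleGraph V) (A : Finset V) : Finset V :=
  Finset.univ.filter fun v => ∃ X : Finset V, SideCrit G A X ∧ v ∈ X

/-- `{A, B}` is a bipartition of `G`: both sides nonempty, disjoint, covering all
vertices, and every edge goes between `A` and `B`. -/
def IsBipartition (G : SimpleGraph V) (A B : Finset V) : Prop :=
  A.Nonempty ∧ B.Nonempty ∧ Disjoint A B ∧ A ∪ B = Finset.univ ∧
    ∀ u v : V, G.Adj u v → (u ∈ A ∧ v ∈ B) ∨ (u ∈ B ∧ v ∈ A)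

theorem nbr_union (G : SimpleGraph V) (X Y : Finset V) :
    nbr G (X ∪ Y) = nbr G X ∪ nbr G Y := by
  ext v
  simp only [nbr, mem_filter, mem_univ, true_and, mem_union]
  grind

theorem IsBipartition.symm {G : SimpleGraph V} {A B : Finset V} (h : IsBipartition G A B) :
    IsBipartition G B A := by
  obtain ⟨hA, hB, hdisj, hcover, hadj⟩ := h
  exact ⟨hB, hA, hdisj.symm, by rwa [union_comm], fun u v huv => (hadj u v huv).symm⟩

theorem IsBipartition.nbr_subset {G : SimpleGraph V} {A B X : Finset V}
    (h : IsBipartition G A B) (hX : X ⊆ A) : nbr G X ⊆ B := by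
  obtain ⟨-, -, hdisj, -, hadj⟩ := h
  intro v hv
  simp only [nbr, mem_filter, mem_univ, true_and] at hv
  obtain ⟨x, hx, hvx⟩ := hv
  rcases hadj v x hvx with ⟨-, hxB⟩ | ⟨hvB, -⟩
  · exact absurd hxB (disjoint_left.mp hdisj (hX hx))
  · exact hvB

/-- The difference is additive over the two sides of a bipartite graph. -/
theorem IsBipartition.diffZ_union {G : SimpleGraph V} {A B X Y : Finset V}
    (h : IsBipartition G A B) (hX : X ⊆ A) (hY : Y ⊆ B) :
    diffZ G (X ∪ Y) = diffZ G X + diffZ G Y := by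
  have hdisj : Disjoint A B := h.2.2.1
  have hXY : Disjoint X Y := disjoint_of_subset_left hX (disjoint_of_subset_right hY hdisj)
  have hN : Disjoint (nbr G X) (nbr G Y) :=
    disjoint_of_subset_left (h.nbr_subset hX)
      (disjoint_of_subset_right (h.symm.nbr_subset hY) hdisj.symm)
  simp only [diffZ, nbr_union, card_union_of_disjoint hXY, card_union_of_disjoint hN]
  push_cast
  ring

theorem diffZ_le_delta0 (G : SimpleGraph V) {A X : Finset V} (hX : X ⊆ A) :
    diffZ G X ≤ delta0 G A :=
  le_sup' (diffZ G) (mem_powerset.mpr hX)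

theorem exists_diffZ_eq_delta0 (G : SimpleGraph V) (A : Finset V) :
    ∃ X ⊆ A, delta0 G A = diffZ G X := by
  obtain ⟨X, hX, hXA⟩ := exists_mem_eq_sup' (powerset_nonempty A) (diffZ G)
  exact ⟨X, mem_powerset.mp hX, hXA⟩

/-- For every finite bipartite graph `G = (A,B,E)`,
`d_c(G) = δ₀(A) + δ₀(B)`. -/
theorem critDiff_eq_delta0_add_delta0 (G : SimpleGraph V) (A B : Finset V)
    (hbip : IsBipartition G A B) :
    critDiff G = delta0 G A + delta0 G B := by
  change delta0 G univ = _
  apply le_antisymm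
  · obtain ⟨X, -, hX⟩ := exists_diffZ_eq_delta0 G univ
    have hsplit : X ∩ A ∪ X ∩ B = X := by
      rw [← inter_union_distrib_left, hbip.2.2.2.1, inter_univ]
    rw [hX, ← hsplit, hbip.diffZ_union inter_subset_right inter_subset_right]
    exact add_le_add (diffZ_le_delta0 G inter_subset_right) (diffZ_le_delta0 G inter_subset_right)
  · obtain ⟨X, hXA, hX⟩ := exists_diffZ_eq_delta0 G A
    obtain ⟨Y, hYB, hY⟩ := exists_diffZ_eq_delta0 G B
    rw [hX, hY, ← hbip.diffZ_union hXA hYB]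
    exact diffZ_le_delta0 G (subset_univ _)
end

section
/- In a finite bipartite graph G=(A,B,E), if Z is a d-critical independent set, then Z∩A is an A-critical set and Z∩B is a B-critical set. -/
open Finset

open scoped Classical

variable {V : Type*} [Fintype V] [DecidableEq V]

theorem diffZ_le_critDiff (G : SimpleGraph V) (X : Finset V) : diffZ G X ≤ critDiff G :=
  le_sup' (diffZ G) (mem_powerset.mpr (subset_univ X))

theorem IsBipartition.sideCrit_inter_left {G : SimpleGraph V} {A B Z : Finset V}
    (h : IsBipartition G A B) (hZ : diffZ G Z = critDiff G) : SideCrit G A (Z ∩ A) := by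
  refine ⟨inter_subset_right, le_antisymm
    (le_sup' (diffZ G) (mem_powerset.mpr inter_subset_right)) (sup'_le _ _ fun X hX => ?_)⟩
  have hsplit : (Z ∩ A) ∪ (Z ∩ B) = Z := by
    rw [← inter_union_distrib_left, h.2.2.2.1, inter_univ]
  have hZsum := h.diffZ_union (X := Z ∩ A) (Y := Z ∩ B) inter_subset_right inter_subset_right
  have hXsum := h.diffZ_union (Y := Z ∩ B) (mem_powerset.mp hX) inter_subset_right
  have hle := diffZ_le_critDiff G (X ∪ (Z ∩ B))
  rw [hsplit] at hZsum
  linarith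

/-- In a finite bipartite graph, if `Z` is a `d`-critical independent set, then
`Z ∩ A` is `A`-critical and `Z ∩ B` is `B`-critical. -/
theorem inter_sides_of_critical_indep (G : SimpleGraph V) (A B : Finset V)
    (hbip : IsBipartition G A B) (Z : Finset V)
    (hZind : IsIndep G Z) (hZcrit : diffZ G Z = critDiff G) :
    SideCrit G A (Z ∩ A) ∧ SideCrit G B (Z ∩ B) := by
  exact ⟨hbip.sideCrit_inter_left hZcrit, hbip.symm.sideCrit_inter_left hZcrit⟩
end

section
/- In a finite bipartite graph G=(A,B,E), if X is either an A-critical set or a B-critical set, then there is a matching from N(X) into X, i.e., a set of pairwise non-incident edges of G saturating every vertex of N(X) and with all other endpoints in X. -/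
open Finset

open scoped Classical

variable {V : Type*} [Fintype V] [DecidableEq V]

theorem diffZ_le_of_sideCrit {G : SimpleGraph V} {A X Y : Finset V} (hX : SideCrit G A X)
    (hY : Y ⊆ X) : diffZ G Y ≤ diffZ G X := by
  rw [hX.2]
  exact Finset.le_sup' (diffZ G) (Finset.mem_powerset.2 (hY.trans hX.1))

/-- Hall's condition, from `N(X)` into `X`, when `X` has maximum difference among its subsets. -/
theorem card_le_card_filter_adj {G : SimpleGraph V} {X S : Finset V}
    (hmax : ∀ Y ⊆ X, diffZ G Y ≤ diffZ G X) (hS : S ⊆ nbr G X) :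
    S.card ≤ (X.filter fun x => ∃ v ∈ S, G.Adj v x).card := by
  set U := X.filter fun x => ∃ v ∈ S, G.Adj v x with hU
  have hsub : nbr G (X \ U) ⊆ nbr G X \ S := by
    intro v hv
    simp only [nbr, hU, mem_filter, mem_univ, true_and, mem_sdiff] at hv ⊢
    obtain ⟨x, ⟨hxX, hxU⟩, hadj⟩ := hv
    exact ⟨⟨x, hxX, hadj⟩, fun hvS => hxU ⟨hxX, v, hvS, hadj⟩⟩
  have hd := hmax (X \ U) sdiff_subset
  have hN := card_le_card hsub
  have hUX : U ⊆ X := filter_subset _ _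
  have hXU := card_sdiff_add_card_eq_card hUX
  have hNS := card_sdiff_add_card_eq_card hS
  unfold diffZ at hd
  omega

/-- If `X` has maximum difference among its subsets, then `N(X)` injects into `X` along edges. -/
theorem exists_injective_adj_of_diffZ_max {G : SimpleGraph V} {X : Finset V}
    (hmax : ∀ Y ⊆ X, diffZ G Y ≤ diffZ G X) :
    ∃ f : nbr G X → V, Function.Injective f ∧ ∀ v, f v ∈ X ∧ G.Adj v (f v) := by
  obtain ⟨f, hf, hfX⟩ := (Finset.all_card_le_biUnion_card_iff_exists_injective
    fun v : nbr G X => X.filter fun x => G.Adj v x).1 fun S => by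
      have h := card_le_card_filter_adj (S := S.map (Function.Embedding.subtype _)) hmax
        fun v hv => by
          obtain ⟨w, -, rfl⟩ := mem_map.1 hv
          exact w.2
      rw [card_map] at h
      refine h.trans (card_le_card fun x hx => ?_)
      obtain ⟨hxX, v, hv, hadj⟩ := mem_filter.1 hx
      obtain ⟨w, hw, rfl⟩ := mem_map.1 hv
      exact mem_biUnion.2 ⟨w, hw, mem_filter.2 ⟨hxX, hadj⟩⟩
  exact ⟨f, hf, fun v => mem_filter.1 (hfX v)⟩

theorem IsBipartition.disjoint_nbr {G : SimpleGraph V} {A B X : Finset V}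
    (h : IsBipartition G A B) (hX : X ⊆ A) : Disjoint (nbr G X) X := by
  rw [Finset.disjoint_left]
  intro v hv hvX
  obtain ⟨x, hx, hadj⟩ := (mem_filter.1 hv).2
  rcases h.2.2.2.2 v x hadj with ⟨-, hxB⟩ | ⟨hvB, -⟩
  · exact Finset.disjoint_left.1 h.2.2.1 (hX hx) hxB
  · exact Finset.disjoint_left.1 h.2.2.1 (hX hvX) hvB

/-- An injection along the edges between disjoint sets gives a matching. -/
theorem exists_isMatchingSet_of_injective {G : SimpleGraph V} {N X : Finset V}
    (hdisj : Disjoint N X) {f : N → V} (hf : Function.Injective f)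
    (hfX : ∀ v, f v ∈ X ∧ G.Adj v (f v)) :
    ∃ M : Finset (Sym2 V), IsMatchingSet G M ∧
      (∀ v ∈ N, ∃ e ∈ M, v ∈ e) ∧
      (∀ e ∈ M, ∃ v ∈ N, ∃ x ∈ X, e = s(v, x)) := by
  have hne : ∀ v w : N, (v : V) ≠ f w := fun v w h =>
    Finset.disjoint_left.1 hdisj v.2 (h ▸ (hfX w).1)
  refine ⟨univ.image fun v : N => s((v : V), f v), ⟨?_, ?_⟩, ?_, ?_⟩
  · intro e he
    obtain ⟨v, -, rfl⟩ := mem_image.1 he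
    exact (hfX v).2
  · intro e he e' he' hee' u hu
    obtain ⟨v, -, rfl⟩ := mem_image.1 (mem_coe.1 he)
    obtain ⟨w, -, rfl⟩ := mem_image.1 (mem_coe.1 he')
    refine hee' (congrArg (fun v : N => s((v : V), f v)) ?_)
    obtain ⟨rfl | rfl, h | h⟩ := And.imp Sym2.mem_iff.1 Sym2.mem_iff.1 hu
    · exact Subtype.ext h
    · exact (hne _ _ h).elim
    · exact (hne _ _ h.symm).elim
    · exact hf h
  · exact fun v hv => ⟨_, mem_image_of_mem _ (mem_univ ⟨v, hv⟩), Sym2.mem_mk_left _ _⟩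
  · intro e he
    obtain ⟨v, -, rfl⟩ := mem_image.1 he
    exact ⟨v, v.2, f v, (hfX v).1, rfl⟩

/-- In a finite bipartite graph, if `X` is `A`-critical or `B`-critical, then
there is a matching from `N(X)` into `X`: a set of pairwise non-incident edges
saturating every vertex of `N(X)`, all of whose edges join `N(X)` to `X`. -/
theorem matching_from_nbr_into_sideCrit (G : SimpleGraph V) (A B : Finset V)
    (hbip : IsBipartition G A B) (X : Finset V)
    (hX : SideCrit G A X ∨ SideCrit G B X) :
    ∃ M : Finset (Sym2 V), IsMatchingSet G M ∧
      (∀ v ∈ nbr G X, ∃ e ∈ M, v ∈ e) ∧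
      (∀ e ∈ M, ∃ v ∈ nbr G X, ∃ x ∈ X, e = s(v, x)) := by
  have hdisj : Disjoint (nbr G X) X :=
    hX.elim (fun h => hbip.disjoint_nbr h.1) fun h => hbip.symm.disjoint_nbr h.1
  obtain ⟨f, hf, hfX⟩ := exists_injective_adj_of_diffZ_max fun Y hY =>
    hX.elim (diffZ_le_of_sideCrit · hY) (diffZ_le_of_sideCrit · hY)
  exact exists_isMatchingSet_of_injective hdisj hf hfX
end

section
/- In a finite bipartite graph G=(A,B,E), if X⊆A is an A-critical set and Y⊆B is a B-critical set, then |X∩N(Y)| = |N(X)∩Y|; moreover, there is a set of pairwise non-incident edges of G matching the set X∩N(Y) onto the set N(X)∩Y. -/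
open Finset

open scoped Classical

variable {V : Type*} [Fintype V] [DecidableEq V]

/-- The neighborhood of `X \ N(T)` avoids `T`, so removing `N(T)` from a critical set `X`
yields Hall's condition for the subsets `T` of `N(X)`. -/
theorem SideCrit.card_le_card_inter_nbr {G : SimpleGraph V} {A X T : Finset V}
    (hX : SideCrit G A X) (hT : T ⊆ nbr G X) : T.card ≤ (X ∩ nbr G T).card := by
  have hmax : diffZ G (X \ nbr G T) ≤ diffZ G X := by
    rw [hX.2]
    exact Finset.le_sup' (diffZ G) (Finset.mem_powerset.2 (Finset.sdiff_subset.trans hX.1))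
  have hsub : nbr G (X \ nbr G T) ⊆ nbr G X \ T := by
    intro v hv
    simp only [nbr, Finset.mem_filter, Finset.mem_univ, true_and, Finset.mem_sdiff] at hv ⊢
    obtain ⟨x, ⟨hxX, hxT⟩, hvx⟩ := hv
    exact ⟨⟨x, hxX, hvx⟩, fun hvT => hxT ⟨v, hvT, hvx.symm⟩⟩
  have hcard := Finset.card_le_card hsub
  have hN := Finset.card_sdiff_add_card_eq_card hT
  have hXT := Finset.card_sdiff_add_card_inter X (nbr G T)
  unfold diffZ at hmax
  omega

/-- Every subset of `N(X)` can be matched into a critical set `X`. -/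
theorem SideCrit.exists_injective_adj {G : SimpleGraph V} {A X S : Finset V}
    (hX : SideCrit G A X) (hS : S ⊆ nbr G X) :
    ∃ f : S → V, Function.Injective f ∧ ∀ y, f y ∈ X ∩ nbr G S ∧ G.Adj (f y) y := by
  obtain ⟨f, hf, hmem⟩ := (Finset.all_card_le_biUnion_card_iff_exists_injective
    fun y : S => X.filter fun x => G.Adj x y).1 fun T => by
      have hT : T.map (Function.Embedding.subtype _) ⊆ nbr G X := by
        intro v hv
        obtain ⟨y, -, rfl⟩ := Finset.mem_map.1 hv
        exact hS y.2
      rw [← Finset.card_map (Function.Embedding.subtype _)]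
      refine (hX.card_le_card_inter_nbr hT).trans (Finset.card_le_card fun x hx => ?_)
      simp only [nbr, Finset.mem_inter, Finset.mem_filter, Finset.mem_univ, true_and,
        Finset.mem_map] at hx
      obtain ⟨hxX, _, ⟨y, hyT, rfl⟩, hxy⟩ := hx
      exact Finset.mem_biUnion.2 ⟨y, hyT, Finset.mem_filter.2 ⟨hxX, hxy⟩⟩
  refine ⟨f, hf, fun y => ?_⟩
  obtain ⟨hfX, hadj⟩ := Finset.mem_filter.1 (hmem y)
  exact ⟨Finset.mem_inter.2 ⟨hfX, Finset.mem_filter.2 ⟨Finset.mem_univ _, y, y.2, hadj⟩⟩, hadj⟩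

theorem nbr_mono (G : SimpleGraph V) {S T : Finset V} (h : S ⊆ T) : nbr G S ⊆ nbr G T := by
  intro v hv
  simp only [nbr, Finset.mem_filter, Finset.mem_univ, true_and] at hv ⊢
  obtain ⟨x, hx, hvx⟩ := hv
  exact ⟨x, h hx, hvx⟩

theorem SideCrit.card_nbr_inter_le {G : SimpleGraph V} {A X : Finset V} (hX : SideCrit G A X)
    (Y : Finset V) : (nbr G X ∩ Y).card ≤ (X ∩ nbr G Y).card :=
  (hX.card_le_card_inter_nbr Finset.inter_subset_left).trans
    (Finset.card_le_card (Finset.inter_subset_inter_left (nbr_mono G Finset.inter_subset_right)))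

/-- In a finite bipartite graph, if `X ⊆ A` is `A`-critical and `Y ⊆ B` is
`B`-critical, then `|X ∩ N(Y)| = |N(X) ∩ Y|`, and moreover there is a set of
pairwise non-incident edges matching `X ∩ N(Y)` onto `N(X) ∩ Y`. -/
theorem card_inter_nbr_eq_and_matching (G : SimpleGraph V) (A B : Finset V)
    (hbip : IsBipartition G A B) (X Y : Finset V)
    (hX : SideCrit G A X) (hY : SideCrit G B Y) :
    (X ∩ nbr G Y).card = (nbr G X ∩ Y).card ∧
    ∃ M : Finset (Sym2 V), IsMatchingSet G M ∧
      (∀ v ∈ X ∩ nbr G Y, ∃ e ∈ M, v ∈ e) ∧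
      (∀ v ∈ nbr G X ∩ Y, ∃ e ∈ M, v ∈ e) ∧
      (∀ e ∈ M, ∃ u ∈ X ∩ nbr G Y, ∃ w ∈ nbr G X ∩ Y, e = s(u, w)) := by
  have hcard : (X ∩ nbr G Y).card = (nbr G X ∩ Y).card := by
    refine le_antisymm ?_ (hX.card_nbr_inter_le Y)
    rw [Finset.inter_comm X, Finset.inter_comm _ Y]
    exact hY.card_nbr_inter_le X
  obtain ⟨f, hf, hfadj⟩ := hX.exists_injective_adj (S := nbr G X ∩ Y) Finset.inter_subset_left
  have hfmem : ∀ y, f y ∈ X ∩ nbr G Y := fun y =>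
    Finset.inter_subset_inter_left (nbr_mono G Finset.inter_subset_right) (hfadj y).1
  have himage : Finset.univ.image f = X ∩ nbr G Y := by
    refine Finset.eq_of_subset_of_card_le (Finset.image_subset_iff.2 fun y _ => hfmem y) ?_
    rw [Finset.card_image_of_injective _ hf, Finset.card_univ, Fintype.card_coe, hcard]
  have hne : ∀ y z : (nbr G X ∩ Y : Finset V), f y ≠ z := fun y z =>
    Finset.disjoint_iff_ne.1 hbip.2.2.1 _ (hX.1 (Finset.mem_inter.1 (hfmem y)).1) _
      (hY.1 (Finset.mem_inter.1 z.2).2)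
  refine ⟨hcard, Finset.univ.image fun y => s(f y, (y : V)), ⟨?_, ?_⟩, ?_, ?_, ?_⟩
  · intro e he
    obtain ⟨y, -, rfl⟩ := Finset.mem_image.1 he
    exact (hfadj y).2
  · intro e he e' he' hee' v hv
    obtain ⟨y, -, rfl⟩ := Finset.mem_image.1 (Finset.mem_coe.1 he)
    obtain ⟨z, -, rfl⟩ := Finset.mem_image.1 (Finset.mem_coe.1 he')
    have hyz : y ≠ z := fun h => hee' (by rw [h])
    rcases Sym2.mem_iff.1 hv.1 with h | h <;> rcases Sym2.mem_iff.1 hv.2 with h' | h'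
    · exact hyz (hf (h.symm.trans h'))
    · exact hne y z (h.symm.trans h')
    · exact hne z y (h'.symm.trans h)
    · exact hyz (Subtype.ext (h.symm.trans h'))
  · intro v hv
    rw [← himage] at hv
    obtain ⟨y, -, rfl⟩ := Finset.mem_image.1 hv
    exact ⟨_, Finset.mem_image_of_mem _ (Finset.mem_univ y), Sym2.mem_mk_left _ _⟩
  · intro v hv
    exact ⟨_, Finset.mem_image_of_mem _ (Finset.mem_univ ⟨v, hv⟩), Sym2.mem_mk_right _ _⟩
  · intro e he
    obtain ⟨y, -, rfl⟩ := Finset.mem_image.1 he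
    exact ⟨f y, hfmem y, y, y.2, rfl⟩
end

section
/- Let X be a critical independent set in a finite simple graph G. Then X = ker(G) if and only if for each vertex v∈X there exists a matching from N(X) into X−{v}, i.e., a set of pairwise non-incident edges saturating every vertex of N(X) and with all other endpoints in X−{v}. -/
open Finset

open scoped Classical

variable {V : Type*} [Fintype V] [DecidableEq V]

theorem mem_nbr {G : SimpleGraph V} {X : Finset V} {v : V} :
    v ∈ nbr G X ↔ ∃ x ∈ X, G.Adj v x := by
  simp [nbr]

theorem IsIndep.notMem_nbr {G : SimpleGraph V} {X : Finset V} (hX : IsIndep G X) {v : V}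
    (hv : v ∈ X) : v ∉ nbr G X := by
  rw [mem_nbr]
  rintro ⟨x, hx, hvx⟩
  exact hX v hv x hx hvx

theorem IsIndep.diffZ_le_idc {G : SimpleGraph V} {S : Finset V} (hS : IsIndep G S) :
    diffZ G S ≤ idc G :=
  Finset.le_sup' (diffZ G) (by simpa using hS)

/-- Deleting from `W` its non-isolated vertices leaves an independent set without decreasing
the difference, so `idc` bounds the difference of every set of vertices. -/
theorem diffZ_le_idc (G : SimpleGraph V) (W : Finset V) : diffZ G W ≤ idc G := by
  have hI : IsIndep G (W \ nbr G W) := by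
    intro u hu v hv huv
    exact (mem_sdiff.1 hu).2 (mem_nbr.2 ⟨v, (mem_sdiff.1 hv).1, huv⟩)
  have hN : nbr G (W \ nbr G W) ⊆ nbr G W \ W := by
    intro u hu
    obtain ⟨x, hx, hux⟩ := mem_nbr.1 hu
    rw [mem_sdiff] at hx ⊢
    exact ⟨mem_nbr.2 ⟨x, hx.1, hux⟩, fun huW => hx.2 (mem_nbr.2 ⟨u, huW, hux.symm⟩)⟩
  have hle := hI.diffZ_le_idc
  have hcard := card_le_card hN
  have h₁ := card_sdiff_add_card_inter W (nbr G W)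
  have h₂ := card_sdiff_add_card_inter (nbr G W) W
  rw [inter_comm] at h₂
  unfold diffZ at *
  omega

theorem diffZ_add_diffZ_le (G : SimpleGraph V) (X Y : Finset V) :
    diffZ G X + diffZ G Y ≤ diffZ G (X ∩ Y) + diffZ G (X ∪ Y) := by
  have hU : nbr G (X ∪ Y) = nbr G X ∪ nbr G Y := by
    ext v
    simp only [mem_nbr, mem_union]
    grind
  have hI : nbr G (X ∩ Y) ⊆ nbr G X ∩ nbr G Y := by
    intro v
    simp only [mem_nbr, mem_inter]
    grind
  have hcard := card_le_card hI
  have h₁ := card_union_add_card_inter X Y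
  have h₂ := card_union_add_card_inter (nbr G X) (nbr G Y)
  unfold diffZ
  rw [hU]
  omega

/-- If `X = ker(G)`, then every nonempty `A ⊆ N(X)` has more than `|A|` neighbors in `X`. -/
theorem card_lt_card_nbr_inter_of_eq_kerSet {G : SimpleGraph V} {X A : Finset V}
    (hX : CritIndep G X) (hker : X = kerSet G) (hA : A ⊆ nbr G X) (hne : A.Nonempty) :
    A.card < (X ∩ nbr G A).card := by
  by_contra! hle
  have hN : nbr G (X \ nbr G A) ⊆ nbr G X \ A := by
    intro u hu
    obtain ⟨x, hx, hux⟩ := mem_nbr.1 hu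
    rw [mem_sdiff] at hx ⊢
    exact ⟨mem_nbr.2 ⟨x, hx.1, hux⟩, fun huA => hx.2 (mem_nbr.2 ⟨u, huA, hux.symm⟩)⟩
  have hcrit : CritIndep G (X \ nbr G A) := by
    refine ⟨fun u hu v hv => hX.1 u (mem_sdiff.1 hu).1 v (mem_sdiff.1 hv).1,
      (diffZ_le_idc G _).antisymm ?_⟩
    have hcard := card_le_card hN
    have h₁ := card_sdiff_add_card_inter X (nbr G A)
    have h₂ := card_sdiff_add_card_eq_card hA
    rw [← hX.2]
    unfold diffZ
    omega
  obtain ⟨a, ha⟩ := hne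
  obtain ⟨x, hx, hax⟩ := mem_nbr.1 (hA ha)
  have hx' := hx
  rw [hker, kerSet, mem_filter] at hx'
  exact (mem_sdiff.1 (hx'.2 _ hcrit)).2 (mem_nbr.2 ⟨a, ha, hax.symm⟩)

theorem exists_matching_of_eq_kerSet {G : SimpleGraph V} {X : Finset V}
    (hX : CritIndep G X) (hker : X = kerSet G) (v : V) :
    ∃ M : Finset (Sym2 V), IsMatchingSet G M ∧
      (∀ u ∈ nbr G X, ∃ e ∈ M, u ∈ e) ∧
      (∀ e ∈ M, ∃ u ∈ nbr G X, ∃ x ∈ X.erase v, e = s(u, x)) := by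
  obtain ⟨f, hf, hft⟩ := (Finset.all_card_le_biUnion_card_iff_exists_injective
      (fun u : nbr G X => (X.erase v).filter (G.Adj u))).1 (by
    intro s
    rcases s.eq_empty_or_nonempty with rfl | hs
    · simp
    have hlt := card_lt_card_nbr_inter_of_eq_kerSet hX hker (A := s.map (.subtype _))
      (by intro u; simp only [mem_map]; rintro ⟨a, -, rfl⟩; exact a.2) (by simpa using hs)
    have hsub : (X ∩ nbr G (s.map (.subtype _))).erase v ⊆
        s.biUnion fun u : nbr G X => (X.erase v).filter (G.Adj u) := by
      intro x hx
      obtain ⟨hxv, hx⟩ := mem_erase.1 hx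
      obtain ⟨hxX, hx⟩ := mem_inter.1 hx
      obtain ⟨a, ha, hxa⟩ := mem_nbr.1 hx
      obtain ⟨u, hu, rfl⟩ := mem_map.1 ha
      exact mem_biUnion.2 ⟨u, hu, mem_filter.2 ⟨mem_erase.2 ⟨hxv, hxX⟩, hxa.symm⟩⟩
    have h₁ := card_le_card hsub
    have h₂ := pred_card_le_card_erase (s := X ∩ nbr G (s.map (.subtype _))) (a := v)
    rw [card_map] at hlt
    omega)
  simp only [mem_filter] at hft
  have hne (a b : nbr G X) : (a : V) ≠ f b := fun h =>
    hX.1.notMem_nbr (mem_of_mem_erase (hft b).1) (h ▸ a.2)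
  refine ⟨univ.image fun u : nbr G X => s((u : V), f u), ⟨?_, ?_⟩, ?_, ?_⟩
  · simp only [mem_image, mem_univ, true_and]
    rintro _ ⟨u, rfl⟩
    exact (hft u).2
  · intro e he e' he' hee' w hw
    simp only [coe_image, coe_univ, Set.image_univ, Set.mem_range] at he he'
    obtain ⟨a, rfl⟩ := he
    obtain ⟨b, rfl⟩ := he'
    have hab : a ≠ b := by rintro rfl; exact hee' rfl
    simp only [Sym2.mem_iff] at hw
    obtain ⟨rfl | rfl, h | h⟩ := hw
    · exact hab (Subtype.ext h)
    · exact hne _ _ h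
    · exact hne _ _ h.symm
    · exact hab (hf h)
  · intro u hu
    exact ⟨_, mem_image_of_mem _ (mem_univ ⟨u, hu⟩), Sym2.mem_mk_left _ _⟩
  · simp only [mem_image, mem_univ, true_and]
    rintro _ ⟨u, rfl⟩
    exact ⟨u, u.2, f u, (hft u).1, rfl⟩

/-- A matching from `N(X)` into `X - {v}` forces `d(Y) < d(X)` for all `Y ⊆ X - {v}`. -/
theorem diffZ_lt_of_matching {G : SimpleGraph V} {X Y : Finset V} {v : V} {M : Finset (Sym2 V)}
    (hX : IsIndep G X) (hv : v ∈ X) (hYX : Y ⊆ X) (hvY : v ∉ Y) (hM : IsMatchingSet G M)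
    (hsat : ∀ u ∈ nbr G X, ∃ e ∈ M, u ∈ e)
    (hend : ∀ e ∈ M, ∃ u ∈ nbr G X, ∃ x ∈ X.erase v, e = s(u, x)) :
    diffZ G Y < diffZ G X := by
  have hpartner : ∀ u ∈ nbr G X, ∃ x ∈ X.erase v, s(u, x) ∈ M := by
    intro u hu
    obtain ⟨e, he, hue⟩ := hsat u hu
    obtain ⟨w, -, x, hx, rfl⟩ := hend e he
    obtain rfl | rfl := Sym2.mem_iff.1 hue
    · exact ⟨x, hx, he⟩
    · exact absurd hu (hX.notMem_nbr (mem_of_mem_erase hx))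
  choose! f hfX hfM using hpartner
  have hNYX : nbr G Y ⊆ nbr G X := by
    intro u hu
    obtain ⟨y, hy, huy⟩ := mem_nbr.1 hu
    exact mem_nbr.2 ⟨y, hYX hy, huy⟩
  have hle : (nbr G X \ nbr G Y).card ≤ ((X \ Y).erase v).card := by
    refine card_le_card_of_injOn f ?_ ?_
    · intro u hu
      obtain ⟨huX, huY⟩ := mem_sdiff.1 hu
      obtain ⟨hne, hmem⟩ := mem_erase.1 (hfX u huX)
      refine mem_erase.2 ⟨hne, mem_sdiff.2 ⟨hmem, fun hfY => huY ?_⟩⟩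
      exact mem_nbr.2 ⟨f u, hfY, hM.1 _ (hfM u huX)⟩
    · intro a ha b hb hab
      have haX := (mem_sdiff.1 ha).1
      have hbX := (mem_sdiff.1 hb).1
      have heq : s(a, f a) = s(b, f b) := by
        by_contra hne
        exact hM.2 (hfM a haX) (hfM b hbX) hne (f a) ⟨by simp, by simp [hab]⟩
      rw [hab] at heq
      exact Sym2.congr_left.1 heq
  have hlt := card_erase_lt_of_mem (mem_sdiff.2 ⟨hv, hvY⟩)
  have h₁ := card_sdiff_add_card_eq_card hYX
  have h₂ := card_sdiff_add_card_eq_card hNYX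
  unfold diffZ
  omega

/-- A critical independent set `X` equals `ker(G)` iff for each `v ∈ X` there
is a matching from `N(X)` into `X - {v}`: a set of pairwise non-incident edges
saturating every vertex of `N(X)`, all of whose edges join `N(X)` to `X - {v}`. -/
theorem eq_kerSet_iff_matching_avoiding_vertex (G : SimpleGraph V) (X : Finset V)
    (hX : CritIndep G X) :
    X = kerSet G ↔
      ∀ v ∈ X, ∃ M : Finset (Sym2 V), IsMatchingSet G M ∧
        (∀ u ∈ nbr G X, ∃ e ∈ M, u ∈ e) ∧
        (∀ e ∈ M, ∃ u ∈ nbr G X, ∃ x ∈ X.erase v, e = s(u, x)) := by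
  constructor
  · exact fun hker v _ => exists_matching_of_eq_kerSet hX hker v
  · intro h
    ext v
    refine ⟨fun hv => mem_filter.2 ⟨mem_univ v, fun S hS => ?_⟩,
      fun hv => (mem_filter.1 hv).2 X hX⟩
    by_contra hvS
    obtain ⟨M, hM, hsat, hend⟩ := h v hv
    have hlt := diffZ_lt_of_matching hX.1 hv (Y := X ∩ S) inter_subset_left
      (fun hmem => hvS (mem_inter.1 hmem).2) hM hsat hend
    have hsuper := diffZ_add_diffZ_le G X S
    have hle := diffZ_le_idc G (X ∪ S)
    rw [hS.2] at hsuper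
    omega
end

section
/- Let G=(A,B,E) be a finite bipartite graph with a perfect matching M, let S be a maximum independent set of G, and let X be an independent set with X ⊆ V(G)−S such that the subgraph of G induced by X∪M(X) is connected, where M(X) denotes the set of M-mates of the vertices of X. Then the set X¹ = X ∪ M((N(X)∩S) − M(X)) is independent, and the subgraph of G induced by X¹∪M(X¹) is connected. -/
open Finset

open scoped Classical

variable {V : Type*} [Fintype V] [DecidableEq V]

/-- In a bipartite graph with a perfect matching, a maximum independent set contains
an endpoint of every matching edge. -/
theorem IsMaxIndep.mate_mem_of_notMem {G : SimpleGraph V} {A B : Finset V}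
    (hbip : IsBipartition G A B) {m : V → V} (hadj : ∀ v : V, G.Adj v (m v))
    (hinv : ∀ v : V, m (m v) = v) {S : Finset V} (hS : IsMaxIndep G S) {v : V}
    (hv : v ∉ S) : m v ∈ S := by
  obtain ⟨-, -, hdisj, hcover, hedge⟩ := hbip
  have hside : ∀ u, u ∈ A → u ∉ B := fun u hA hB => Finset.disjoint_left.1 hdisj hA hB
  have hle : ∀ T : Finset V, IsIndep G T → T.card ≤ S.card := by
    intro T hT
    rw [hS.2]
    exact Finset.le_sup (f := Finset.card) (by simpa using hT)
  have hA : A.card ≤ S.card := hle A fun u hu w hw h => by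
    rcases hedge u w h with h' | h'
    exacts [hside w hw h'.2, hside u hu h'.1]
  have hB : B.card ≤ S.card := hle B fun u hu w hw h => by
    rcases hedge u w h with h' | h'
    exacts [hside u h'.1 hu, hside w h'.2 hw]
  have hmS : (S.image m).card = S.card :=
    Finset.card_image_of_injective S (Function.LeftInverse.injective hinv)
  have hdisjS : Disjoint S (S.image m) := by
    rw [Finset.disjoint_left]
    intro u hu hu'
    obtain ⟨w, hw, rfl⟩ := Finset.mem_image.1 hu'
    exact hS.1 w hw _ hu (hadj w)
  have huniv : S ∪ S.image m = Finset.univ := by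
    apply Finset.eq_univ_of_card
    have h1 := Finset.card_union_of_disjoint hdisjS
    have h2 := Finset.card_union_of_disjoint hdisj
    rw [hcover, Finset.card_univ] at h2
    have h3 := Finset.card_le_univ (S ∪ S.image m)
    omega
  have hmem : v ∈ S ∪ S.image m := huniv ▸ Finset.mem_univ v
  rcases Finset.mem_union.1 hmem with h | h
  · exact absurd h hv
  · obtain ⟨w, hw, rfl⟩ := Finset.mem_image.1 h
    rwa [hinv]

/-- The endpoints of an edge lie on opposite sides of a bipartition. -/
theorem IsBipartition.mem_left_iff_of_adj {G : SimpleGraph V} {A B : Finset V}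
    (hbip : IsBipartition G A B) {u v : V} (h : G.Adj u v) : u ∈ A ↔ v ∉ A := by
  obtain ⟨-, -, hdisj, -, hedge⟩ := hbip
  have hside := Finset.disjoint_left.1 hdisj
  rcases hedge u v h with ⟨hu, hv⟩ | ⟨hu, hv⟩
  · exact iff_of_true hu fun h' => hside h' hv
  · exact iff_of_false (fun h' => hside h' hu) (not_not.2 hv)

/-- If `X` and `Y` are independent and `X ∪ Y` induces a connected subgraph of a bipartite
graph, then `X` lies on a single side of the bipartition. -/
theorem IsBipartition.mem_left_iff_of_connected {G : SimpleGraph V} {A B : Finset V}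
    (hbip : IsBipartition G A B) {X Y : Finset V} (hX : IsIndep G X) (hY : IsIndep G Y)
    (hconn : (G.induce (↑(X ∪ Y) : Set V)).Connected) {x y : V} (hx : x ∈ X) (hy : y ∈ X) :
    x ∈ A ↔ y ∈ A := by
  have hstep : ∀ u v : (↑(X ∪ Y) : Set V), (G.induce (↑(X ∪ Y) : Set V)).Adj u v →
      (((u : V) ∈ X ↔ (u : V) ∈ A) ↔ ((v : V) ∈ X ↔ (v : V) ∈ A)) := by
    rintro ⟨u, hu⟩ ⟨v, hv⟩ huv
    have huv' : G.Adj u v := huv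
    have hside := hbip.mem_left_iff_of_adj huv'
    have hnX : u ∈ X → v ∉ X := fun h h' => hX u h v h' huv'
    have hnY : u ∈ Y → v ∉ Y := fun h h' => hY u h v h' huv'
    have hu' : u ∈ X ∨ u ∈ Y := by simpa using hu
    have hv' : v ∈ X ∨ v ∈ Y := by simpa using hv
    change (u ∈ X ↔ u ∈ A) ↔ (v ∈ X ↔ v ∈ A)
    tauto
  have hwalk : ∀ u v : (↑(X ∪ Y) : Set V), (G.induce (↑(X ∪ Y) : Set V)).Walk u v →
      (((u : V) ∈ X ↔ (u : V) ∈ A) ↔ ((v : V) ∈ X ↔ (v : V) ∈ A)) := by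
    intro u v p
    induction p with
    | nil => rfl
    | cons h _ ih => exact (hstep _ _ h).trans ih
  have hx' : x ∈ (↑(X ∪ Y) : Set V) := by simp [hx]
  have hy' : y ∈ (↑(X ∪ Y) : Set V) := by simp [hy]
  obtain ⟨p⟩ := hconn.preconnected ⟨x, hx'⟩ ⟨y, hy'⟩
  simpa [hx, hy] using hwalk _ _ p

/-- Let `G = (A,B,E)` be a finite bipartite graph with a perfect matching
(given as an involution `m` matching every vertex to an adjacent one), let `S`
be a maximum independent set, and let `X` be an independent set disjoint from
`S` such that the subgraph induced by `X ∪ M(X)` is connected. Then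
`X¹ = X ∪ M((N(X) ∩ S) - M(X))` is independent and the subgraph induced by
`X¹ ∪ M(X¹)` is connected. -/
theorem indep_and_connected_extension (G : SimpleGraph V) (A B : Finset V)
    (hbip : IsBipartition G A B)
    (m : V → V) (hadj : ∀ v : V, G.Adj v (m v)) (hinv : ∀ v : V, m (m v) = v)
    (S : Finset V) (hS : IsMaxIndep G S)
    (X : Finset V) (hXind : IsIndep G X) (hXS : Disjoint X S)
    (hconn : (G.induce (↑(X ∪ X.image m) : Set V)).Connected) :
    ∀ X1 : Finset V, X1 = X ∪ ((nbr G X ∩ S) \ X.image m).image m →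
      IsIndep G X1 ∧ (G.induce (↑(X1 ∪ X1.image m) : Set V)).Connected := by
  rintro X1 rfl
  have hmX : ∀ x ∈ X, m x ∈ S := fun x hx =>
    hS.mate_mem_of_notMem hbip hadj hinv (Finset.disjoint_left.1 hXS hx)
  have hmXind : IsIndep G (X.image m) := by
    intro u hu v hv
    obtain ⟨x, hx, rfl⟩ := Finset.mem_image.1 hu
    obtain ⟨y, hy, rfl⟩ := Finset.mem_image.1 hv
    exact hS.1 _ (hmX x hx) _ (hmX y hy)
  set X1 := X ∪ ((nbr G X ∩ S) \ X.image m).image m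
  have hcase : ∀ z ∈ X1, z ∈ X ∨ ∃ x ∈ X, G.Adj (m z) x := by
    intro z hz
    rcases Finset.mem_union.1 hz with hz | hz
    · exact Or.inl hz
    · obtain ⟨y, hy, rfl⟩ := Finset.mem_image.1 hz
      have hyN := (Finset.mem_inter.1 (Finset.mem_sdiff.1 hy).1).1
      rw [hinv]
      exact Or.inr (Finset.mem_filter.1 hyN).2
  constructor
  · have hsame : ∀ z ∈ X1, ∃ x ∈ X, (z ∈ A ↔ x ∈ A) := by
      intro z hz
      rcases hcase z hz with hz | ⟨x, hx, hzx⟩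
      · exact ⟨z, hz, Iff.rfl⟩
      · have h1 := hbip.mem_left_iff_of_adj (hadj z)
        have h2 := hbip.mem_left_iff_of_adj hzx
        exact ⟨x, hx, by tauto⟩
    intro u hu v hv huv
    obtain ⟨x, hx, hux⟩ := hsame u hu
    obtain ⟨y, hy, hvy⟩ := hsame v hv
    have hxy := hbip.mem_left_iff_of_connected hXind hmXind hconn hx hy
    have hside := hbip.mem_left_iff_of_adj huv
    tauto
  · have hXX1 : X ⊆ X1 := Finset.subset_union_left
    have hsub : (↑(X ∪ X.image m) : Set V) ⊆ (↑(X1 ∪ X1.image m) : Set V) :=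
      Finset.coe_subset.2 (Finset.union_subset_union hXX1 (Finset.image_subset_image hXX1))
    obtain ⟨b, hb⟩ := hconn.nonempty
    have hold : ∀ v (hv : v ∈ (↑(X ∪ X.image m) : Set V)),
        (G.induce (↑(X1 ∪ X1.image m) : Set V)).Reachable ⟨b, hsub hb⟩ ⟨v, hsub hv⟩ :=
      fun v hv => (hconn.preconnected ⟨b, hb⟩ ⟨v, hv⟩).map
        (SimpleGraph.induceHomOfLE G hsub).toHom
    have hmate : ∀ z (hz : z ∈ (↑(X1 ∪ X1.image m) : Set V))
        (hmz : m z ∈ (↑(X1 ∪ X1.image m) : Set V)), z ∈ X1 →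
        (G.induce (↑(X1 ∪ X1.image m) : Set V)).Reachable ⟨b, hsub hb⟩ ⟨z, hz⟩ ∧
        (G.induce (↑(X1 ∪ X1.image m) : Set V)).Reachable ⟨b, hsub hb⟩ ⟨m z, hmz⟩ := by
      intro z hz hmz hzX1
      rcases hcase z hzX1 with hzX | ⟨x, hx, hzx⟩
      · exact ⟨hold z (by simp [hzX]), hold (m z)
          (Finset.mem_coe.2 (Finset.mem_union_right _ (Finset.mem_image_of_mem m hzX)))⟩
      · have hxX : x ∈ (↑(X ∪ X.image m) : Set V) := by simp [hx]
        have hxz : (G.induce (↑(X1 ∪ X1.image m) : Set V)).Adj ⟨x, hsub hxX⟩ ⟨m z, hmz⟩ :=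
          hzx.symm
        have hzz : (G.induce (↑(X1 ∪ X1.image m) : Set V)).Adj ⟨m z, hmz⟩ ⟨z, hz⟩ :=
          (hadj z).symm
        have hr := (hold x hxX).trans hxz.reachable
        exact ⟨hr.trans hzz.reachable, hr⟩
    rw [SimpleGraph.connected_iff_exists_forall_reachable]
    refine ⟨⟨b, hsub hb⟩, ?_⟩
    rintro ⟨v, hv⟩
    rcases Finset.mem_union.1 (Finset.mem_coe.1 hv) with h | h
    · exact (hmate v hv
        (Finset.mem_coe.2 (Finset.mem_union_right _ (Finset.mem_image_of_mem m h))) h).1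
    · obtain ⟨z, hz, rfl⟩ := Finset.mem_image.1 h
      exact (hmate z (Finset.mem_coe.2 (Finset.mem_union_left _ hz)) hv hz).2
end

section
/- If G is a finite König–Egerváry graph, then |ker(G)| + |diadem(G)| ≤ 2α(G). -/
open Finset

open scoped Classical

variable {V : Type*} [Fintype V] [DecidableEq V]

theorem exists_critIndep (G : SimpleGraph V) : ∃ S : Finset V, CritIndep G S := by
  obtain ⟨S, hS, h⟩ := Finset.exists_mem_eq_sup'
    (s := (Finset.univ : Finset V).powerset.filter (IsIndep G)) ⟨∅, by simp [IsIndep]⟩ (diffZ G)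
  exact ⟨S, (Finset.mem_filter.1 hS).2, h.symm⟩

theorem exists_isMatchingSet_card_eq_matchNum (G : SimpleGraph V) :
    ∃ M : Finset (Sym2 V), IsMatchingSet G M ∧ M.card = matchNum G := by
  obtain ⟨M, hM, h⟩ := Finset.exists_mem_eq_sup
    ((Finset.univ : Finset (Sym2 V)).powerset.filter (IsMatchingSet G))
    ⟨∅, by simp [IsMatchingSet]⟩ Finset.card
  exact ⟨M, (Finset.mem_filter.1 hM).2, h.symm⟩

theorem kerSet_subset_diademSet (G : SimpleGraph V) : kerSet G ⊆ diademSet G := by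
  intro v hv
  obtain ⟨S, hS⟩ := exists_critIndep G
  simp only [kerSet, diademSet, Finset.mem_filter, Finset.mem_univ, true_and] at hv ⊢
  exact ⟨S, hS, hv S hS⟩

theorem notMem_diademSet_of_adj_of_mem_kerSet {G : SimpleGraph V} {a b : V} (hab : G.Adj a b)
    (ha : a ∈ kerSet G) : b ∉ diademSet G := by
  intro hb
  simp only [kerSet, diademSet, Finset.mem_filter, Finset.mem_univ, true_and] at ha hb
  obtain ⟨S, hS, hbS⟩ := hb
  exact hS.1 a (ha S hS) b hbS hab

/-- The traces of a set of vertices on the edges of a matching are disjoint. -/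
theorem IsMatchingSet.sum_card_filter_mem_le {G : SimpleGraph V} {M : Finset (Sym2 V)}
    (hM : IsMatchingSet G M) (A : Finset V) :
    ∑ e ∈ M, (A.filter (· ∈ e)).card ≤ A.card := by
  rw [← Finset.card_biUnion]
  · exact Finset.card_le_card (Finset.biUnion_subset.2 fun e _ => Finset.filter_subset _ _)
  · intro e he f hf hef
    refine Finset.disjoint_left.2 fun v hve hvf => hM.2 he hf hef v ?_
    exact ⟨(Finset.mem_filter.1 hve).2, (Finset.mem_filter.1 hvf).2⟩

/-- Every edge misses `ker(G)` and `diadem(G)` at least twice in total. -/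
theorem two_le_card_filter_compl_kerSet_add {G : SimpleGraph V} {e : Sym2 V}
    (he : e ∈ G.edgeSet) :
    2 ≤ ((kerSet G)ᶜ.filter (· ∈ e)).card + ((diademSet G)ᶜ.filter (· ∈ e)).card := by
  induction e using Sym2.ind with
  | _ a b =>
    have hab : G.Adj a b := he
    have key : ∀ {x y : V}, G.Adj x y → x ∈ kerSet G → y ∈ s(a, b) →
        2 ≤ ((kerSet G)ᶜ.filter (· ∈ s(a, b))).card
          + ((diademSet G)ᶜ.filter (· ∈ s(a, b))).card := by
      intro x y hxy hx hy
      have hyD := notMem_diademSet_of_adj_of_mem_kerSet hxy hx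
      have hyK : y ∉ kerSet G := fun h => hyD (kerSet_subset_diademSet G h)
      exact Nat.add_le_add
        (Finset.card_pos.2 ⟨y, Finset.mem_filter.2 ⟨Finset.mem_compl.2 hyK, hy⟩⟩)
        (Finset.card_pos.2 ⟨y, Finset.mem_filter.2 ⟨Finset.mem_compl.2 hyD, hy⟩⟩)
    by_cases ha : a ∈ kerSet G
    · exact key hab ha (Sym2.mem_mk_right a b)
    by_cases hb : b ∈ kerSet G
    · exact key hab.symm hb (Sym2.mem_mk_left a b)
    refine le_add_right (Nat.succ_le_of_lt (Finset.one_lt_card.2 ⟨a, ?_, b, ?_, hab.ne⟩)) <;>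
      simp [ha, hb]

/-- If `G` is a finite König–Egerváry graph, then
`|ker(G)| + |diadem(G)| ≤ 2α(G)`. -/
theorem kerSet_card_add_diademSet_card_le (G : SimpleGraph V)
    (hke : indepNum G + matchNum G = Fintype.card V) :
    (kerSet G).card + (diademSet G).card ≤ 2 * indepNum G := by
  obtain ⟨M, hM, hcard⟩ := exists_isMatchingSet_card_eq_matchNum G
  have hsum := Finset.card_nsmul_le_sum M _ 2
    fun e he => two_le_card_filter_compl_kerSet_add (hM.1 e he)
  rw [Finset.sum_add_distrib, smul_eq_mul] at hsum
  have hK := hM.sum_card_filter_mem_le (kerSet G)ᶜ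
  have hD := hM.sum_card_filter_mem_le (diademSet G)ᶜ
  have hK' := Finset.card_add_card_compl (kerSet G)
  have hD' := Finset.card_add_card_compl (diademSet G)
  omega
end
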